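/- Memory obsolescence (Proposition 4): for every Boolean expression e over atoms A and every memory ℳ, eval(e, ℳ) = eval(rw(e, ℳ), ∅), where ∅ is the empty memory. Consequently, for every EHE 𝒱 and every key (t, q) ∈ dom 𝒱, eval(𝒱(t, q), ℳ) = eval(inc(𝒱, ℳ)(t, q), ∅). -/

import Mathlib

open Classical

namespace DecSpec

/-- Merge of two dicts (partial functions) with a binary operation `op`. -/
def dmerge {α β : Type*} (op : β → β → β) (f g : α → Option β) : α → Option β :=
  fun x =>
    match f x, g x with
    | some a, some b => some (op a b)
    | some a, none   => some a
    | none,   some b => some b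
    | none,   none   => none

/-- Boolean expressions over atoms `A`. -/
inductive Expr (A : Type*) : Type _ where
  | tt : Expr A
  | ff : Expr A
  | atom : A → Expr A
  | not : Expr A → Expr A
  | and : Expr A → Expr A → Expr A
  | or : Expr A → Expr A → Expr A

/-- Boolean semantics of an expression under a valuation. -/
def Expr.evalv {A : Type*} (v : A → Bool) : Expr A → Bool
  | .tt => true
  | .ff => false
  | .atom a => v a
  | .not e => !(e.evalv v)
  | .and e1 e2 => e1.evalv v && e2.evalv v
  | .or e1 e2 => e1.evalv v || e2.evalv v

/-- Semantic equivalence of expressions. -/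
def Expr.equiv {A : Type*} (e e' : Expr A) : Prop := ∀ v, e.evalv v = e'.evalv v

/-- Apply an encoder to every atom of an expression. -/
def Expr.map {A B : Type*} (f : A → B) : Expr A → Expr B
  | .tt => .tt
  | .ff => .ff
  | .atom a => .atom (f a)
  | .not e => .not (e.map f)
  | .and e1 e2 => .and (e1.map f) (e2.map f)
  | .or e1 e2 => .or (e1.map f) (e2.map f)

/-- The set of atoms occurring in an expression. -/
def Expr.atoms {A : Type*} : Expr A → Set A
  | .tt => ∅
  | .ff => ∅
  | .atom a => {a}
  | .not e => e.atoms
  | .and e1 e2 => e1.atoms ∪ e2.atoms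
  | .or e1 e2 => e1.atoms ∪ e2.atoms

/-- The three-valued verdict domain 𝔹₃ = {⊤, ⊥, ?}. -/
inductive Verdict : Type where
  | vt | vf | vna
deriving DecidableEq

/-- A memory is a partial function from atoms to verdicts. -/
abbrev Mem (A : Type*) := A → Option Verdict

/-- The empty memory. -/
def emptyMem {A : Type*} : Mem A := fun _ => none

/-- Rewrite an expression using a memory: replace atoms carrying final verdicts. -/
def Expr.rw {A : Type*} (M : Mem A) : Expr A → Expr A
  | .tt => .tt
  | .ff => .ff
  | .atom a =>
    match M a with
    | some .vt => .tt
    | some .vf => .ff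
    | _ => .atom a
  | .not e => .not (e.rw M)
  | .and e1 e2 => .and (e1.rw M) (e2.rw M)
  | .or e1 e2 => .or (e1.rw M) (e2.rw M)

def Expr.tautology {A : Type*} (e : Expr A) : Prop := ∀ v, e.evalv v = true
def Expr.unsat {A : Type*} (e : Expr A) : Prop := ∀ v, e.evalv v = false

/-- Evaluate an expression against a memory: ⊤ if the rewrite is a tautology,
⊥ if it is unsatisfiable, ? otherwise. -/
noncomputable def evalM {A : Type*} (e : Expr A) (M : Mem A) : Verdict :=
  if (e.rw M).tautology then .vt
  else if (e.rw M).unsat then .vf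
  else .vna

/-- A valuation is consistent with a memory. -/
def consistent {A : Type*} (v : A → Bool) (M : Mem A) : Prop :=
  (∀ a, M a = some .vt → v a = true) ∧ (∀ a, M a = some .vf → v a = false)

/-- An event assigns at most one final verdict (modeled as a `Bool`) to each
atomic proposition. -/
abbrev Event (AP : Type*) := AP → Option Bool

def Event.nonempty {AP : Type*} (evt : Event AP) : Prop := ∃ ap, evt ap ≠ none

/-- Final verdicts as verdicts. -/
def b2v : Bool → Verdict := fun b => if b then .vt else .vf

/-- `cons(evt, id)`: the memory over `AP` built from an event with the identity encoder. -/
def consId {AP : Type*} (evt : Event AP) : Mem AP := fun ap => (evt ap).map b2v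

/-- The timestamp encoder `ts_t`. -/
def tsEnc {AP : Type*} (t : ℕ) (ap : AP) : ℕ × AP := (t, ap)

/-- `⊎²_{t ∈ [1, i]} cons(evt_t, ts_t)`: the memory over timestamped atoms built
from the events at timestamps `1, …, i` with the timestamp encoders. -/
def tsMem {AP : Type*} (evts : ℕ → Event AP) (i : ℕ) : Mem (ℕ × AP) :=
  fun p => if 1 ≤ p.1 ∧ p.1 ≤ i then (evts p.1 p.2).map b2v else none

/-- A specification (Moore) automaton. -/
structure SpecAut (AP : Type*) (Q : Type*) where
  q0 : Q
  δ : Q → Expr AP → Option Q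
  ver : Q → Verdict

variable {AP Q : Type*}

/-- At most one labeled transition between each ordered pair of states. -/
def SpecAut.UniqueLabels (A : SpecAut AP Q) : Prop :=
  ∀ q q' e e', A.δ q e = some q' → A.δ q e' = some q' → e = e'

/-- Determinism: for every state and memory at most one outgoing label
evaluates to ⊤. -/
def SpecAut.Deterministic (A : SpecAut AP Q) : Prop :=
  ∀ (q : Q) (M : Mem AP) (e1 e2 : Expr AP) (q1 q2 : Q),
    A.δ q e1 = some q1 → A.δ q e2 = some q2 →
    evalM e1 M = .vt → evalM e2 M = .vt → e1 = e2

/-- Completeness: for every state the disjunction of the outgoing labels is a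
tautology. -/
def SpecAut.Complete (A : SpecAut AP Q) : Prop :=
  ∀ (q : Q) (v : AP → Bool), ∃ (e : Expr AP) (q' : Q),
    A.δ q e = some q' ∧ e.evalv v = true

/-- The transition function `Δ` over events. -/
noncomputable def SpecAut.step (A : SpecAut AP Q) (q : Q) (evt : Event AP) : Q :=
  if h : evt.nonempty ∧ ∃ (q' : Q) (e : Expr AP),
      A.δ q e = some q' ∧ evalM e (consId evt) = .vt
  then h.2.choose
  else q

/-- `Δ*`: the extension of `Δ` to finite sequences of events. -/
noncomputable def SpecAut.run (A : SpecAut AP Q) (q : Q) : List (Event AP) → Q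
  | [] => q
  | evt :: rest => A.run (A.step q evt) rest

/-- An Execution History Encoding of `A`. -/
abbrev EHE (AP : Type*) (Q : Type*) := ℕ × Q → Option (Expr (ℕ × AP))

/-- EHE merge `⊎∨`: disjoin expressions at keys in both domains. -/
def eheMerge {AP Q : Type*} (V1 V2 : EHE AP Q) : EHE AP Q := dmerge Expr.or V1 V2

/-- `to(𝒱, t, q', enc)`: disjunction of `𝒱(t, q) ∧ enc(e')` over all `(q, e')`
with `(t, q) ∈ dom 𝒱` and `δ(q, e') = some q'`. -/
noncomputable def toExpr [Fintype Q] (A : SpecAut AP Q) (V : EHE AP Q) (t : ℕ)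
    (q' : Q) (enc : AP → ℕ × AP) : Expr (ℕ × AP) :=
  (Finset.univ : Finset Q).toList.foldr
    (fun q acc =>
      match V (t, q) with
      | none => acc
      | some eV =>
        if h : ∃ e', A.δ q e' = some q' then .or (.and eV (h.choose.map enc)) acc
        else acc)
    .ff

/-- States having a transition from some state in the domain of `𝒱` at `t`. -/
def nextStates (A : SpecAut AP Q) (V : EHE AP Q) (t : ℕ) (q' : Q) : Prop :=
  ∃ (q : Q) (e' : Expr AP), V (t, q) ≠ none ∧ A.δ q e' = some q'

/-- One step of `move`: `𝒱 ↦ 𝒱 ⊎∨ ⨄∨_{q'} [(t+1, q') ↦ to(𝒱, t, q', ts_{t+1})]`. -/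
noncomputable def moveStep [Fintype Q] (A : SpecAut AP Q) (V : EHE AP Q) (t : ℕ) :
    EHE AP Q :=
  eheMerge V (fun p =>
    if p.1 = t + 1 ∧ nextStates A V t p.2
    then some (toExpr A V t p.2 (tsEnc (t + 1)))
    else none)

noncomputable def moveN [Fintype Q] (A : SpecAut AP Q) (V : EHE AP Q) (t0 : ℕ) :
    ℕ → EHE AP Q
  | 0 => V
  | k + 1 => moveStep A (moveN A V t0 k) (t0 + k)

/-- `move(𝒱, t_s, t_e)`. -/
noncomputable def move [Fintype Q] (A : SpecAut AP Q) (V : EHE AP Q) (ts te : ℕ) :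
    EHE AP Q :=
  moveN A V ts (te - ts)

/-- The initial EHE `[(0, q0) ↦ tt]`. -/
noncomputable def initEHE (A : SpecAut AP Q) : EHE AP Q :=
  fun p => if p = (0, A.q0) then some .tt else none

/-- `reach(𝒱, ℳ, t)`: the state whose expression at `t` evaluates to ⊤, if any. -/
noncomputable def reach {AP Q : Type*} (V : EHE AP Q) (M : Mem (ℕ × AP)) (t : ℕ) :
    Option Q :=
  if h : ∃ (q : Q) (e : Expr (ℕ × AP)), V (t, q) = some e ∧ evalM e M = .vt
  then some h.choose
  else none

/-- `inc(𝒱, ℳ)`: incorporate a memory into an EHE by rewriting every entry. -/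
def inc {κ A : Type*} (V : κ → Option (Expr A)) (M : Mem A) : κ → Option (Expr A) :=
  fun k => (V k).map (Expr.rw M)

/-- Two memories have no conflicting observations. -/
def noConflict {A : Type*} (M1 M2 : Mem A) : Prop :=
  ∀ a v1 v2, M1 a = some v1 → M2 a = some v2 → v1 = v2

/-- A fixed linear order on verdicts (for memory merge `⊎²`). -/
def Verdict.rank : Verdict → ℕ
  | .vna => 0
  | .vf => 1
  | .vt => 2

/-- Maximum of two verdicts under the fixed linear order. -/
def vmax (a b : Verdict) : Verdict := if a.rank ≤ b.rank then b else a

/-- Memory merge `⊎²`: keep the larger verdict at common keys. -/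
def memMerge {A : Type*} (M1 M2 : Mem A) : Mem A := dmerge vmax M1 M2


/-- Proposition 4, memory obsolescence: evaluating an expression
against a memory is the same as evaluating its rewrite against the empty
memory; consequently an EHE with an incorporated memory evaluates, against the
empty memory, exactly as the original EHE against that memory. -/
theorem memory_obsolescence {κ A : Type*} :
    (∀ (e : Expr A) (M : Mem A),
      evalM e M = evalM (e.rw M) (emptyMem : Mem A)) ∧
    (∀ (V : κ → Option (Expr A)) (M : Mem A) (k : κ) (e : Expr A),
      V k = some e →
      ∃ e' : Expr A, inc V M k = some e' ∧
        evalM e M = evalM e' (emptyMem : Mem A)) := by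
  have rw_empty : ∀ e : Expr A, e.rw (emptyMem : Mem A) = e := by
    intro e
    induction e with
    | tt => rfl
    | ff => rfl
    | atom a => rfl
    | not e ih => simp only [Expr.rw, ih]
    | and e1 e2 ih1 ih2 => simp only [Expr.rw, ih1, ih2]
    | or e1 e2 ih1 ih2 => simp only [Expr.rw, ih1, ih2]
  have main : ∀ (e : Expr A) (M : Mem A),
      evalM e M = evalM (e.rw M) (emptyMem : Mem A) := by
    intro e M
    unfold evalM
    rw [rw_empty]
  refine ⟨main, ?_⟩
  intro V M k e h
  exact ⟨e.rw M, by simp [inc, h], main e M⟩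

end DecSpec
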